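/- Let λ ∈ h* satisfy λ(z) ≠ 0 and λ(h) ∈ ℤ + 1/2. Then the Verma module Δ(λ) is simple if and only if λ(h) ≤ -3/2. -/

import Mathlib

namespace Schrodinger

noncomputable section

open scoped TensorProduct

/-- Generators of the Schrödinger algebra. -/
inductive Gen : Type
  | E | H | F | P | Q | Z
  deriving DecidableEq

/-- The free algebra on the generators. -/
abbrev FA : Type := FreeAlgebra ℂ Gen

/-- Inclusion of generators. -/
def ιg (g : Gen) : FA := FreeAlgebra.ι ℂ g

/-- The defining relations of the universal enveloping algebra of the Schrödinger
algebra `s`: `z` is central and `[h,e]=2e`, `[e,f]=h`, `[h,f]=-2f`, `[e,q]=p`,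
`[e,p]=0`, `[h,p]=p`, `[f,p]=q`, `[f,q]=0`, `[h,q]=-q`, `[p,q]=z`. -/
inductive Rel : FA → FA → Prop
  | he : Rel (ιg .H * ιg .E) (ιg .E * ιg .H + 2 * ιg .E)
  | ef : Rel (ιg .E * ιg .F) (ιg .F * ιg .E + ιg .H)
  | hf : Rel (ιg .H * ιg .F) (ιg .F * ιg .H - 2 * ιg .F)
  | eq : Rel (ιg .E * ιg .Q) (ιg .Q * ιg .E + ιg .P)
  | ep : Rel (ιg .E * ιg .P) (ιg .P * ιg .E)
  | hp : Rel (ιg .H * ιg .P) (ιg .P * ιg .H + ιg .P)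
  | fp : Rel (ιg .F * ιg .P) (ιg .P * ιg .F + ιg .Q)
  | fq : Rel (ιg .F * ιg .Q) (ιg .Q * ιg .F)
  | hq : Rel (ιg .H * ιg .Q) (ιg .Q * ιg .H - ιg .Q)
  | pq : Rel (ιg .P * ιg .Q) (ιg .Q * ιg .P + ιg .Z)
  | ze : Rel (ιg .Z * ιg .E) (ιg .E * ιg .Z)
  | zh : Rel (ιg .Z * ιg .H) (ιg .H * ιg .Z)
  | zf : Rel (ιg .Z * ιg .F) (ιg .F * ιg .Z)
  | zp : Rel (ιg .Z * ιg .P) (ιg .P * ιg .Z)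
  | zq : Rel (ιg .Z * ιg .Q) (ιg .Q * ιg .Z)

/-- The universal enveloping algebra `U = U(s)` of the Schrödinger algebra,
presented by generators and relations (via the PBW theorem). -/
abbrev U : Type := RingQuot Rel

/-- The generators of `U`. -/
def gen (g : Gen) : U := RingQuot.mkAlgHom ℂ Rel (ιg g)

def E : U := gen .E
def H : U := gen .H
def F : U := gen .F
def P : U := gen .P
def Q : U := gen .Q
def Z : U := gen .Z

/-- Scalars inside `U`. -/
def sc (a : ℂ) : U := algebraMap ℂ U a

/-- The Casimir element `c = (h² + h + 4fe)z − 2(fp² − eq² − hpq)`. -/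
def cElt : U := (H * H + H + 4 * (F * E)) * Z - 2 * (F * (P * P) - E * (Q * Q) - H * (P * Q))

/-- The left ideal of `U` defining the Verma module `Δ(λ)` for
`λ ∈ 𝔥*` with `λ(h) = hh`, `λ(z) = zz`:  it is generated by `n₊ = span{e,p}`
together with `h - λ(h)` and `z - λ(z)`; then
`Δ(λ) = U ⊗_{U(𝔟)} ℂ_λ ≅ U / U(e, p, h - λ(h), z - λ(z))`. -/
def vermaIdeal (hh zz : ℂ) : Submodule U U :=
  Submodule.span U ({E, P, H - sc hh, Z - sc zz} : Set U)

/-- The Verma module `Δ(λ)` with highest weight `λ`, `λ(h) = hh`, `λ(z) = zz`. -/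
abbrev Verma (hh zz : ℂ) : Type := U ⧸ vermaIdeal hh zz

/-- The canonical highest weight generator `v_λ` of `Δ(λ)`. -/
def hwVec (hh zz : ℂ) : Verma hh zz := Submodule.Quotient.mk 1

/-- The unique maximal submodule `K(λ)` of `Δ(λ)`. -/
def vermaRad (hh zz : ℂ) : Submodule U (Verma hh zz) := sSup {N : Submodule U (Verma hh zz) | N ≠ ⊤}

/-- The simple highest weight module `L(λ) = Δ(λ)/K(λ)`. -/
abbrev SimpleHW (hh zz : ℂ) : Type := Verma hh zz ⧸ vermaRad hh zz

/-- The scalar `ϑ_λ = (λ(h)² + 3λ(h) + 2)·λ(z)` by which the Casimir element `c`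
acts on the Verma module `Δ(λ)`. -/
def vartheta (hh zz : ℂ) : ℂ := (hh ^ 2 + 3 * hh + 2) * zz

end

end Schrodinger

namespace Schrodinger


noncomputable section

/-- Induction principle for the enveloping algebra: it is generated by the six generators. -/
theorem U.induction {p : U → Prop} (algebraMap : ∀ a : ℂ, p (algebraMap ℂ U a))
    (gen : ∀ g, p (gen g)) (add : ∀ a b, p a → p b → p (a + b))
    (mul : ∀ a b, p a → p b → p (a * b)) (u : U) : p u := by
  obtain ⟨w, rfl⟩ := RingQuot.mkAlgHom_surjective ℂ Rel u
  induction w using FreeAlgebra.induction with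
  | grade0 r => simpa using algebraMap r
  | grade1 g => exact gen g
  | mul a b ha hb => simpa using mul _ _ ha hb
  | add a b ha hb => simpa using add _ _ ha hb

/-- The underlying space of the concrete model of the Verma module, with basis indexed by `ℕ × ℕ`.
The basis vector `(i, j)` models `q ^ i (f + q² / (2 z)) ^ j v`. -/
def Model (_hh _zz : ℂ) : Type := ℕ × ℕ →₀ ℂ

namespace Model

variable (hh zz : ℂ)

instance : AddCommGroup (Model hh zz) := inferInstanceAs (AddCommGroup (ℕ × ℕ →₀ ℂ))

instance : Module ℂ (Model hh zz) := inferInstanceAs (Module ℂ (ℕ × ℕ →₀ ℂ))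

/-- The standard basis of the model. -/
def basis : Module.Basis (ℕ × ℕ) ℂ (Model hh zz) := Module.Basis.ofRepr (LinearEquiv.refl ℂ _)

/-- The basis vector indexed by `(i, j)`. -/
def vec (i j : ℕ) : Model hh zz := basis hh zz (i, j)

/-- The value of a generator on a basis vector. -/
def actVec : Gen → ℕ × ℕ → Model hh zz
  | .E, (i, j) => ((j : ℂ) * (hh + 3 / 2 - j)) • vec hh zz i (j - 1) +
      ((i : ℂ) * (i - 1) * zz / 2) • vec hh zz (i - 2) j
  | .H, (i, j) => (hh - 2 * j - i) • vec hh zz i j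
  | .F, (i, j) => vec hh zz i (j + 1) - (2 * zz)⁻¹ • vec hh zz (i + 2) j
  | .P, (i, j) => ((i : ℂ) * zz) • vec hh zz (i - 1) j
  | .Q, (i, j) => vec hh zz (i + 1) j
  | .Z, (i, j) => zz • vec hh zz i j

/-- The action of a generator on the model. -/
def act (g : Gen) : Module.End ℂ (Model hh zz) := (basis hh zz).constr ℂ (actVec hh zz g)

theorem act_vec (g : Gen) (i j : ℕ) : act hh zz g (vec hh zz i j) = actVec hh zz g (i, j) :=
  (basis hh zz).constr_basis ℂ _ _

variable {hh zz}

theorem lift_rel (hzz : zz ≠ 0) {a b : FA} (h : Rel a b) :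
    FreeAlgebra.lift ℂ (act hh zz) a = FreeAlgebra.lift ℂ (act hh zz) b := by
  have h2 : (2 : FA) = algebraMap ℂ FA 2 := (map_ofNat (algebraMap ℂ FA) 2).symm
  refine (basis hh zz).ext fun ⟨i, j⟩ => ?_
  change FreeAlgebra.lift ℂ (act hh zz) a (vec hh zz i j) =
    FreeAlgebra.lift ℂ (act hh zz) b (vec hh zz i j)
  cases h <;> rcases i with _ | _ | i <;> rcases j with _ | j <;>
    simp [h2, ιg, act_vec, actVec, Algebra.algebraMap_eq_smul_one, smul_sub, smul_add] <;>
    match_scalars <;> field_simp <;> ring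

/-- The representation of the enveloping algebra on the model. -/
def rep (hzz : zz ≠ 0) : U →ₐ[ℂ] Module.End ℂ (Model hh zz) :=
  RingQuot.liftAlgHom ℂ ⟨FreeAlgebra.lift ℂ (act hh zz), fun _ _ => lift_rel hzz⟩

theorem rep_gen (hzz : zz ≠ 0) (g : Gen) : rep (hh := hh) hzz (gen g) = act hh zz g := by
  simp [rep, gen, ιg]

variable [hzz : NeZero zz]

instance : Module U (Model hh zz) := Module.compHom _ (rep (hh := hh) hzz.out).toRingHom

theorem smul_def (u : U) (x : Model hh zz) : u • x = rep hzz.out u x := rfl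

instance : IsScalarTower ℂ U (Model hh zz) :=
  ⟨fun a u x => by simp [smul_def]⟩

theorem gen_smul_vec (g : Gen) (i j : ℕ) :
    gen g • vec hh zz i j = actVec hh zz g (i, j) := by
  rw [smul_def, rep_gen, act_vec]

end Model

section Linear

variable {M N : Type*} [AddCommGroup M] [AddCommGroup N] [Module ℂ M] [Module ℂ N] [Module U M]
  [Module U N] [IsScalarTower ℂ U M] [IsScalarTower ℂ U N]

theorem smul_mem_of_gen_smul_mem (W : Submodule ℂ M) (hW : ∀ g, ∀ x ∈ W, gen g • x ∈ W) (u : U) :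
    ∀ x ∈ W, u • x ∈ W := by
  induction u using U.induction with
  | algebraMap a => exact fun x hx => by simpa using W.smul_mem a hx
  | gen g => exact hW g
  | add a b ha hb => exact fun x hx => by simpa [add_smul] using W.add_mem (ha x hx) (hb x hx)
  | mul a b ha hb => exact fun x hx => by simpa [mul_smul] using ha _ (hb x hx)

/-- A `ℂ`-subspace stable under the generators, as a submodule. -/
def submoduleOfGen (W : Submodule ℂ M) (hW : ∀ g, ∀ x ∈ W, gen g • x ∈ W) : Submodule U M :=
  { W with smul_mem' := fun u x hx => smul_mem_of_gen_smul_mem W hW u x hx }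

/-- A `ℂ`-linear map commuting with the generators, as a `U`-linear map. -/
def linearMapOfGen (f : M →ₗ[ℂ] N) (hf : ∀ g x, f (gen g • x) = gen g • f x) : M →ₗ[U] N :=
  { f with
    map_smul' := fun u => by
      change ∀ x, f (u • x) = u • f x
      induction u using U.induction with
      | algebraMap a => simp
      | gen g => exact hf g
      | add a b ha hb => simp [add_smul, ha, hb]
      | mul a b ha hb => simp [mul_smul, ha, hb] }

end Linear

theorem gen_mul_gen {a b : Gen} {w : FA} (h : Rel (ιg a * ιg b) w) :
    gen a * gen b = RingQuot.mkAlgHom ℂ Rel w := by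
  rw [gen, gen, ← map_mul, RingQuot.mkAlgHom_rel ℂ h]

theorem mkAlgHom_two_mul (a : FA) :
    RingQuot.mkAlgHom ℂ Rel (2 * a) = 2 * RingQuot.mkAlgHom ℂ Rel a := by
  rw [two_mul, two_mul, map_add]

theorem mkAlgHom_ιg (g : Gen) : RingQuot.mkAlgHom ℂ Rel (ιg g) = gen g := rfl

theorem E_mul_F : E * F = F * E + H := by
  simpa [mkAlgHom_ιg, E, H, F, P, Q, Z] using gen_mul_gen .ef

theorem H_mul_F : H * F = F * H - 2 * F := by
  simpa [mkAlgHom_ιg, E, H, F, P, Q, Z, mkAlgHom_two_mul] using gen_mul_gen .hf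

theorem E_mul_Q : E * Q = Q * E + P := by
  simpa [mkAlgHom_ιg, E, H, F, P, Q, Z] using gen_mul_gen .eq

theorem F_mul_P : F * P = P * F + Q := by
  simpa [mkAlgHom_ιg, E, H, F, P, Q, Z] using gen_mul_gen .fp

theorem F_mul_Q : F * Q = Q * F := by
  simpa [mkAlgHom_ιg, E, H, F, P, Q, Z] using gen_mul_gen .fq

theorem H_mul_Q : H * Q = Q * H - Q := by
  simpa [mkAlgHom_ιg, E, H, F, P, Q, Z] using gen_mul_gen .hq

theorem P_mul_Q : P * Q = Q * P + Z := by
  simpa [mkAlgHom_ιg, E, H, F, P, Q, Z] using gen_mul_gen .pq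

theorem Z_comm (u : U) : Z * u = u * Z := by
  induction u using U.induction with
  | algebraMap a => exact (Algebra.commutes a Z).symm
  | gen g =>
    cases g
    · simpa [mkAlgHom_ιg, E, H, F, P, Q, Z] using gen_mul_gen .ze
    · simpa [mkAlgHom_ιg, E, H, F, P, Q, Z] using gen_mul_gen .zh
    · simpa [mkAlgHom_ιg, E, H, F, P, Q, Z] using gen_mul_gen .zf
    · simpa [mkAlgHom_ιg, E, H, F, P, Q, Z] using gen_mul_gen .zp
    · simpa [mkAlgHom_ιg, E, H, F, P, Q, Z] using gen_mul_gen .zq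
    · rfl
  | add a b ha hb => rw [mul_add, add_mul, ha, hb]
  | mul a b ha hb => rw [← mul_assoc, ha, mul_assoc, hb, mul_assoc]

/-- The element `f + q² / (2 z)`, which commutes with `p` and `q` at central charge `zz`. -/
def shiftedF (zz : ℂ) : U := F + (2 * zz)⁻¹ • (Q * Q)

section Commutation

variable {M : Type*} [AddCommGroup M] [Module U M]

theorem E_Q_smul (x : M) : E • Q • x = Q • E • x + P • x := by
  rw [← mul_smul, E_mul_Q, add_smul, mul_smul]

theorem E_F_smul (x : M) : E • F • x = F • E • x + H • x := by
  rw [← mul_smul, E_mul_F, add_smul, mul_smul]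

theorem H_Q_smul (x : M) : H • Q • x = Q • H • x - Q • x := by
  rw [← mul_smul, H_mul_Q, sub_smul, mul_smul]

theorem F_Q_smul (x : M) : F • Q • x = Q • F • x := by
  rw [← mul_smul, F_mul_Q, mul_smul]

theorem P_F_smul (x : M) : P • F • x = F • P • x - Q • x := by
  rw [eq_sub_iff_add_eq, ← mul_smul, ← mul_smul F P, F_mul_P, add_smul]

/-- The vector `q ^ i (f + q² / (2 z)) ^ j v`. -/
def pbwVec (zz : ℂ) (v : M) (i j : ℕ) : M := Q ^ i • shiftedF zz ^ j • v

variable {hh zz : ℂ} {v : M}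

theorem pbwVec_succ_left (i j : ℕ) : pbwVec zz v (i + 1) j = Q • pbwVec zz v i j := by
  rw [pbwVec, pow_succ', mul_smul, pbwVec]

variable [Module ℂ M]

theorem H_F_smul (x : M) : H • F • x = F • H • x - (2 : ℂ) • F • x := by
  rw [← mul_smul, H_mul_F, sub_smul, mul_smul, two_mul, add_smul, two_smul]

theorem P_Q_smul (hZ : ∀ x : M, Z • x = zz • x) (x : M) : P • Q • x = Q • P • x + zz • x := by
  rw [← mul_smul, P_mul_Q, add_smul, mul_smul, hZ]

variable [IsScalarTower ℂ U M]

theorem shiftedF_smul (x : M) : shiftedF zz • x = F • x + (2 * zz)⁻¹ • Q • Q • x := by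
  simp [shiftedF, add_smul, mul_smul]

theorem Q_shiftedF_smul (x : M) : Q • shiftedF zz • x = shiftedF zz • Q • x := by
  simp [shiftedF_smul, F_Q_smul, smul_comm Q (_ : ℂ) (_ : M)]

theorem H_shiftedF_smul (x : M) :
    H • shiftedF zz • x = shiftedF zz • H • x - (2 : ℂ) • shiftedF zz • x := by
  simp only [shiftedF_smul, H_F_smul, H_Q_smul, smul_comm H (_ : ℂ) (_ : M), smul_add, smul_sub]
  simp only [← Algebra.lsmul_coe ℂ ℂ M (_ : U)]
  module

theorem P_shiftedF_smul (hzz : zz ≠ 0) (hZ : ∀ x : M, Z • x = zz • x) (x : M) :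
    P • shiftedF zz • x = shiftedF zz • P • x := by
  simp only [shiftedF_smul, P_F_smul, P_Q_smul hZ, smul_comm P (_ : ℂ) (_ : M), smul_add,
    smul_comm Q (_ : ℂ) (_ : M)]
  simp only [← Algebra.lsmul_coe ℂ ℂ M (_ : U)]
  match_scalars <;> field_simp
  norm_num

theorem E_shiftedF_smul (hzz : zz ≠ 0) (hZ : ∀ x : M, Z • x = zz • x) (x : M) :
    E • shiftedF zz • x =
      shiftedF zz • E • x + H • x + zz⁻¹ • Q • P • x + (1 / 2 : ℂ) • x := by
  simp only [shiftedF_smul, E_F_smul, E_Q_smul, P_Q_smul hZ, smul_comm E (_ : ℂ) (_ : M), smul_add]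
  simp only [← Algebra.lsmul_coe ℂ ℂ M (_ : U)]
  match_scalars <;> field_simp
  norm_num

theorem pbwVec_succ_right (i j : ℕ) :
    pbwVec zz v i (j + 1) = shiftedF zz • pbwVec zz v i j := by
  induction i with
  | zero => simp [pbwVec, pow_succ', mul_smul]
  | succ i ih => rw [pbwVec_succ_left, pbwVec_succ_left, ← Q_shiftedF_smul, ih]

theorem F_smul_pbwVec (i j : ℕ) :
    F • pbwVec zz v i j = pbwVec zz v i (j + 1) - (2 * zz)⁻¹ • pbwVec zz v (i + 2) j := by
  rw [pbwVec_succ_right, shiftedF_smul, pbwVec_succ_left, pbwVec_succ_left, add_sub_cancel_right]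

theorem H_smul_pbwVec (hH : H • v = hh • v) (i j : ℕ) :
    H • pbwVec zz v i j = (hh - 2 * j - i) • pbwVec zz v i j := by
  induction i with
  | zero =>
    induction j with
    | zero => simp [pbwVec, hH]
    | succ j ih =>
      rw [pbwVec_succ_right, H_shiftedF_smul, ih, smul_comm, ← pbwVec_succ_right]
      push_cast
      module
  | succ i ih =>
    rw [pbwVec_succ_left, H_Q_smul, ih, smul_comm, ← pbwVec_succ_left]
    push_cast
    module

theorem P_smul_pbwVec (hzz : zz ≠ 0) (hZ : ∀ x : M, Z • x = zz • x) (hP : P • v = 0) (i j : ℕ) :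
    P • pbwVec zz v i j = ((i : ℂ) * zz) • pbwVec zz v (i - 1) j := by
  induction i with
  | zero =>
    induction j with
    | zero => simp [pbwVec, hP]
    | succ j ih =>
      rw [pbwVec_succ_right, P_shiftedF_smul hzz hZ, ih]
      simp
  | succ i ih =>
    rw [pbwVec_succ_left, P_Q_smul hZ, ih, smul_comm]
    rcases i with _ | i
    · simp
    · simp only [Nat.add_sub_cancel, ← pbwVec_succ_left]
      push_cast
      module

theorem E_smul_pbwVec (hzz : zz ≠ 0) (hZ : ∀ x : M, Z • x = zz • x) (hP : P • v = 0)
    (hE : E • v = 0) (hH : H • v = hh • v) (i j : ℕ) :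
    E • pbwVec zz v i j = ((j : ℂ) * (hh + 3 / 2 - j)) • pbwVec zz v i (j - 1) +
      ((i : ℂ) * (i - 1) * zz / 2) • pbwVec zz v (i - 2) j := by
  induction i with
  | zero =>
    induction j with
    | zero => simp [pbwVec, hE]
    | succ j ih =>
      rw [pbwVec_succ_right, E_shiftedF_smul hzz hZ, ih, H_smul_pbwVec hH,
        P_smul_pbwVec hzz hZ hP]
      rcases j with _ | j <;>
        simp [smul_comm (shiftedF zz) (_ : ℂ) (_ : M), ← pbwVec_succ_right] <;> module
  | succ i ih =>
    rw [pbwVec_succ_left, E_Q_smul, ih, P_smul_pbwVec hzz hZ hP]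
    rcases i with _ | _ | i <;>
      simp [smul_comm Q (_ : ℂ) (_ : M), ← pbwVec_succ_left] <;> module

/-- The `U`-linear map from the model to a module of central charge `zz`, determined by
a highest weight vector. -/
def Model.lift [NeZero zz] (hZ : ∀ x : M, Z • x = zz • x) (hP : P • v = 0)
    (hE : E • v = 0) (hH : H • v = hh • v) : Model hh zz →ₗ[U] M :=
  linearMapOfGen ((basis hh zz).constr ℂ fun ij => pbwVec zz v ij.1 ij.2) fun g x => by
    have hvec (i j : ℕ) : (basis hh zz).constr ℂ (fun ij => pbwVec zz v ij.1 ij.2)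
        (vec hh zz i j) = pbwVec zz v i j := (basis hh zz).constr_basis ℂ _ _
    have hzz : zz ≠ 0 := NeZero.ne zz
    set f := (basis hh zz).constr ℂ fun ij => pbwVec zz v ij.1 ij.2
    suffices f ∘ₗ Algebra.lsmul ℂ ℂ _ (gen g) = Algebra.lsmul ℂ ℂ _ (gen g) ∘ₗ f from
      LinearMap.congr_fun this x
    refine (basis hh zz).ext fun ⟨i, j⟩ => ?_
    change f (gen g • vec hh zz i j) = gen g • f (vec hh zz i j)
    rw [gen_smul_vec, hvec]
    cases g <;> simp only [actVec, map_add, map_sub, map_smul, hvec]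
    · exact (E_smul_pbwVec hzz hZ hP hE hH i j).symm
    · exact (H_smul_pbwVec hH i j).symm
    · exact (F_smul_pbwVec i j).symm
    · exact (P_smul_pbwVec hzz hZ hP i j).symm
    · exact pbwVec_succ_left i j
    · exact (hZ _).symm

theorem Model.lift_vec [NeZero zz] (hZ : ∀ x : M, Z • x = zz • x) (hP : P • v = 0)
    (hE : E • v = 0) (hH : H • v = hh • v) (i j : ℕ) :
    lift hZ hP hE hH (vec hh zz i j) = pbwVec zz v i j :=
  (basis hh zz).constr_basis ℂ _ _

end Commutation

section HighestWeight

variable {hh zz : ℂ}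

theorem smul_hwVec_eq_zero {u : U} (hu : u ∈ ({E, P, H - sc hh, Z - sc zz} : Set U)) :
    u • hwVec hh zz = 0 := by
  rw [hwVec, ← Submodule.Quotient.mk_smul, Submodule.Quotient.mk_eq_zero, smul_eq_mul, mul_one]
  exact Submodule.subset_span hu

theorem E_smul_hwVec : E • hwVec hh zz = 0 := smul_hwVec_eq_zero (by simp)

theorem P_smul_hwVec : P • hwVec hh zz = 0 := smul_hwVec_eq_zero (by simp)

theorem H_smul_hwVec : H • hwVec hh zz = hh • hwVec hh zz := by
  have := smul_hwVec_eq_zero (hh := hh) (zz := zz) (u := H - sc hh) (by simp)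
  simpa [sub_smul, sub_eq_zero, sc] using this

theorem Z_smul_hwVec : Z • hwVec hh zz = zz • hwVec hh zz := by
  have := smul_hwVec_eq_zero (hh := hh) (zz := zz) (u := Z - sc zz) (by simp)
  simpa [sub_smul, sub_eq_zero, sc] using this

theorem exists_smul_hwVec (x : Verma hh zz) : ∃ u : U, u • hwVec hh zz = x := by
  obtain ⟨u, rfl⟩ := Submodule.Quotient.mk_surjective _ x
  exact ⟨u, by rw [hwVec, ← Submodule.Quotient.mk_smul, smul_eq_mul, mul_one]⟩

theorem Z_smul (x : Verma hh zz) : Z • x = zz • x := by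
  obtain ⟨u, rfl⟩ := exists_smul_hwVec x
  rw [← mul_smul, Z_comm, mul_smul, Z_smul_hwVec, smul_comm]

end HighestWeight

namespace Model

variable {hh zz : ℂ}

theorem coord_vec (i j k l : ℕ) :
    (basis hh zz).coord (i, j) (vec hh zz k l) = if k = i ∧ l = j then 1 else 0 := by
  rw [vec, Module.Basis.coord_apply, Module.Basis.repr_self, Finsupp.single_apply]
  simp

theorem exists_coord_eq_zero (x : Model hh zz) :
    ∃ k, ∀ i j, k ≤ i + j → (basis hh zz).coord (i, j) x = 0 := by
  refine ⟨((basis hh zz).repr x).support.sup (fun ij => ij.1 + ij.2) + 1, fun i j hij => ?_⟩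
  by_contra hne
  have hmem : (i, j) ∈ ((basis hh zz).repr x).support := Finsupp.mem_support_iff.2 hne
  have := Finset.le_sup (f := fun ij : ℕ × ℕ => ij.1 + ij.2) hmem
  dsimp only at this
  lia

variable [NeZero zz]

theorem P_smul_vec (i j : ℕ) : P • vec hh zz i j = ((i : ℂ) * zz) • vec hh zz (i - 1) j :=
  gen_smul_vec .P i j

theorem E_smul_vec (i j : ℕ) :
    E • vec hh zz i j = ((j : ℂ) * (hh + 3 / 2 - j)) • vec hh zz i (j - 1) +
      ((i : ℂ) * (i - 1) * zz / 2) • vec hh zz (i - 2) j :=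
  gen_smul_vec .E i j

theorem Q_smul_vec (i j : ℕ) : Q • vec hh zz i j = vec hh zz (i + 1) j :=
  gen_smul_vec .Q i j

theorem F_smul_vec (i j : ℕ) :
    F • vec hh zz i j = vec hh zz i (j + 1) - (2 * zz)⁻¹ • vec hh zz (i + 2) j :=
  gen_smul_vec .F i j

theorem pbwVec_vec (i j : ℕ) : pbwVec zz (vec hh zz 0 0) i j = vec hh zz i j := by
  induction i with
  | zero =>
    induction j with
    | zero => simp [pbwVec]
    | succ j ih =>
      rw [pbwVec_succ_right, ih, shiftedF_smul, F_smul_vec, Q_smul_vec, Q_smul_vec, sub_add_cancel]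
  | succ i ih => rw [pbwVec_succ_left, ih, Q_smul_vec]

theorem coord_P_smul (x : Model hh zz) (i j : ℕ) :
    (basis hh zz).coord (i, j) (P • x) = (i + 1) * zz * (basis hh zz).coord (i + 1, j) x := by
  suffices (basis hh zz).coord (i, j) ∘ₗ Algebra.lsmul ℂ ℂ _ P =
    ((i + 1) * zz) • (basis hh zz).coord (i + 1, j) from LinearMap.congr_fun this x
  refine (basis hh zz).ext fun ⟨k, l⟩ => ?_
  change (basis hh zz).coord (i, j) (P • vec hh zz k l) =
    (i + 1) * zz * (basis hh zz).coord (i + 1, j) (vec hh zz k l)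
  rw [P_smul_vec, map_smul, coord_vec, coord_vec]
  rcases k with _ | k <;> simp
  grind

theorem coord_E_smul (x : Model hh zz) (i j : ℕ) :
    (basis hh zz).coord (i, j) (E • x) =
      (j + 1) * (hh + 1 / 2 - j) * (basis hh zz).coord (i, j + 1) x +
      (i + 2) * (i + 1) * zz / 2 * (basis hh zz).coord (i + 2, j) x := by
  suffices (basis hh zz).coord (i, j) ∘ₗ Algebra.lsmul ℂ ℂ _ E =
    ((j + 1) * (hh + 1 / 2 - j)) • (basis hh zz).coord (i, j + 1) +
      ((i + 2) * (i + 1) * zz / 2) • (basis hh zz).coord (i + 2, j) from LinearMap.congr_fun this x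
  refine (basis hh zz).ext fun ⟨k, l⟩ => ?_
  change (basis hh zz).coord (i, j) (E • vec hh zz k l) =
    (j + 1) * (hh + 1 / 2 - j) * (basis hh zz).coord (i, j + 1) (vec hh zz k l) +
      (i + 2) * (i + 1) * zz / 2 * (basis hh zz).coord (i + 2, j) (vec hh zz k l)
  rw [E_smul_vec, map_add, map_smul, map_smul, coord_vec, coord_vec, coord_vec, coord_vec]
  rcases k with _ | _ | k <;> rcases l with _ | l <;> simp <;> grind

instance : Nontrivial (Model hh zz) := ⟨vec hh zz 0 0, 0, (basis hh zz).ne_zero _⟩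

theorem eq_smul_vec_zero (h : ∀ n : ℕ, hh + 1 / 2 ≠ n) {x : Model hh zz} (hP : P • x = 0)
    (hE : E • x = 0) : x = (basis hh zz).coord (0, 0) x • vec hh zz 0 0 := by
  have hleft (i j : ℕ) : (basis hh zz).coord (i + 1, j) x = 0 := by
    have := coord_P_smul x i j
    rw [hP, map_zero, eq_comm, mul_eq_zero, mul_eq_zero] at this
    simpa [NeZero.ne zz, Nat.cast_add_one_ne_zero] using this
  have hright (j : ℕ) : (basis hh zz).coord (0, j + 1) x = 0 := by
    have := coord_E_smul x 0 j
    rw [hE, map_zero, hleft, mul_zero, add_zero, eq_comm, mul_eq_zero, mul_eq_zero] at this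
    simpa [Nat.cast_add_one_ne_zero, sub_eq_zero, h j, -one_div] using this
  refine (basis hh zz).ext_elem fun ⟨i, j⟩ => ?_
  change (basis hh zz).coord (i, j) x = (basis hh zz).coord (i, j)
    ((basis hh zz).coord (0, 0) x • vec hh zz 0 0)
  rw [map_smul, coord_vec]
  rcases i with _ | i <;> rcases j with _ | j <;> simp [hleft, hright]

theorem vec_zero_mem (h : ∀ n : ℕ, hh + 1 / 2 ≠ n) (N : Submodule U (Model hh zz)) (k : ℕ) :
    ∀ x ∈ N, x ≠ 0 → (∀ i j, k ≤ i + j → (basis hh zz).coord (i, j) x = 0) →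
      vec hh zz 0 0 ∈ N := by
  induction k with
  | zero => exact fun x _ hx hk => (hx ((basis hh zz).ext_elem fun ij => by
      simpa using hk ij.1 ij.2 (Nat.zero_le _))).elim
  | succ k ih =>
    intro x hxN hx hk
    by_cases hP : P • x = 0
    · by_cases hE : E • x = 0
      · have hxv := eq_smul_vec_zero h hP hE
        have hc : (basis hh zz).coord (0, 0) x ≠ 0 := fun hc => hx (by rw [hxv, hc, zero_smul])
        have := (N.restrictScalars ℂ).smul_mem ((basis hh zz).coord (0, 0) x)⁻¹ hxN
        rwa [(inv_smul_eq_iff₀ hc).2 hxv] at this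
      · refine ih _ (N.smul_mem E hxN) hE fun i j hij => ?_
        rw [coord_E_smul, hk _ _ (by lia), hk _ _ (by lia), mul_zero, mul_zero, add_zero]
    · refine ih _ (N.smul_mem P hxN) hP fun i j hij => ?_
      rw [coord_P_smul, hk _ _ (by lia), mul_zero]

theorem isSimpleModule (h : ∀ n : ℕ, hh + 1 / 2 ≠ n) : IsSimpleModule U (Model hh zz) := by
  rw [isSimpleModule_iff]
  refine { eq_bot_or_eq_top := fun N => or_iff_not_imp_left.2 fun hN => ?_ }
  obtain ⟨x, hxN, hx⟩ := N.exists_mem_ne_zero_of_ne_bot hN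
  obtain ⟨k, hk⟩ := exists_coord_eq_zero x
  have hv := vec_zero_mem h N k x hxN hx hk
  rw [← Submodule.restrictScalars_eq_top_iff ℂ U, ← top_le_iff, ← (basis hh zz).span_eq,
    Submodule.span_le]
  rintro _ ⟨⟨i, j⟩, rfl⟩
  change vec hh zz i j ∈ N
  rw [← pbwVec_vec]
  exact N.smul_mem _ (N.smul_mem _ hv)

theorem not_isSimpleModule {n : ℕ} (h : hh + 1 / 2 = n) : ¬ IsSimpleModule U (Model hh zz) := by
  intro hsimple
  set W := Submodule.span ℂ (basis hh zz '' {ij | n < ij.2})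
  have hvec {i j : ℕ} (hj : n < j) : vec hh zz i j ∈ W := Submodule.subset_span ⟨(i, j), hj, rfl⟩
  have hW (g : Gen) : W ≤ W.comap (Algebra.lsmul ℂ ℂ (Model hh zz) (gen g)) := by
    refine Submodule.span_le.2 ?_
    rintro _ ⟨⟨i, j⟩, hj : n < j, rfl⟩
    change gen g • vec hh zz i j ∈ W
    rw [gen_smul_vec]
    cases g
    · refine W.add_mem ?_ (W.smul_mem _ (hvec hj))
      rcases (Nat.succ_le_of_lt hj).eq_or_lt with rfl | hj
      · have : hh + 3 / 2 - (n.succ : ℂ) = 0 := by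
          push_cast
          linear_combination h
        rw [this, mul_zero, zero_smul]
        exact W.zero_mem
      · exact W.smul_mem _ (hvec (by lia))
    · exact W.smul_mem _ (hvec hj)
    · exact W.sub_mem (hvec (by lia)) (W.smul_mem _ (hvec hj))
    · exact W.smul_mem _ (hvec hj)
    · exact hvec hj
    · exact W.smul_mem _ (hvec hj)
  rcases eq_bot_or_eq_top (submoduleOfGen W hW) with hbot | htop
  · have : vec hh zz 0 (n + 1) ∈ submoduleOfGen W hW := hvec n.lt_succ_self
    rw [hbot, Submodule.mem_bot] at this
    exact (basis hh zz).ne_zero _ this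
  · have : vec hh zz 0 0 ∈ submoduleOfGen W hW := htop ▸ Submodule.mem_top
    change vec hh zz 0 0 ∈ W at this
    rw [(basis hh zz).mem_span_image, vec, Module.Basis.repr_self] at this
    simpa using this (Finsupp.mem_support_iff.2 (by simp : Finsupp.single (0, 0) (1 : ℂ) (0, 0) ≠ 0))

theorem isSimpleModule_iff_forall_ne :
    IsSimpleModule U (Model hh zz) ↔ ∀ n : ℕ, hh + 1 / 2 ≠ n :=
  ⟨fun h _ hn => not_isSimpleModule hn h, isSimpleModule⟩

end Model

theorem vermaIdeal_le_ker_toSpanSingleton (hh zz : ℂ) [NeZero zz] :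
    vermaIdeal hh zz ≤ LinearMap.ker (LinearMap.toSpanSingleton U _ (Model.vec hh zz 0 0)) := by
  refine Submodule.span_le.2 ?_
  have hH : H • Model.vec hh zz 0 0 = _ := Model.gen_smul_vec .H 0 0
  have hZ : Z • Model.vec hh zz 0 0 = _ := Model.gen_smul_vec .Z 0 0
  rintro _ (rfl | rfl | rfl | rfl)
  · simp [Model.E_smul_vec]
  · simp [Model.P_smul_vec]
  · simp [sub_smul, hH, sc, Model.actVec]
  · simp [sub_smul, hZ, sc, Model.actVec]

/-- The canonical map from the Verma module to its concrete model. -/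
def vermaToModel (hh zz : ℂ) [NeZero zz] : Verma hh zz →ₗ[U] Model hh zz :=
  (vermaIdeal hh zz).liftQ (LinearMap.toSpanSingleton U _ (Model.vec hh zz 0 0))
    (vermaIdeal_le_ker_toSpanSingleton hh zz)

theorem vermaToModel_hwVec (hh zz : ℂ) [NeZero zz] :
    vermaToModel hh zz (hwVec hh zz) = Model.vec hh zz 0 0 := by
  rw [vermaToModel, hwVec, Submodule.liftQ_apply, LinearMap.toSpanSingleton_apply, one_smul]

/-- The Verma module is isomorphic to its concrete model. -/
def vermaEquivModel (hh zz : ℂ) [NeZero zz] : Verma hh zz ≃ₗ[U] Model hh zz :=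
  LinearEquiv.ofLinearMap (vermaToModel hh zz)
    (Model.lift Z_smul P_smul_hwVec E_smul_hwVec H_smul_hwVec)
    (by
      refine LinearMap.restrictScalars_injective ℂ ((Model.basis hh zz).ext fun ⟨i, j⟩ => ?_)
      change vermaToModel hh zz (Model.lift _ _ _ _ (Model.vec hh zz i j)) = Model.vec hh zz i j
      rw [Model.lift_vec, pbwVec, map_smul, map_smul, vermaToModel_hwVec, ← pbwVec,
        Model.pbwVec_vec])
    (by
      refine LinearMap.ext fun x => ?_
      obtain ⟨u, rfl⟩ := exists_smul_hwVec x
      rw [map_smul, LinearMap.comp_apply, vermaToModel_hwVec, Model.lift_vec, pbwVec, pow_zero,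
        pow_zero, one_smul, one_smul, LinearMap.id_apply])

end

/-- Proposition 4(i) of the paper: let `λ(z) = zz ≠ 0` and
`λ(h) ∈ ℤ + ½`, say `λ(h) = m + ½` with `m ∈ ℤ`.  Then the Verma module `Δ(λ)`
is simple if and only if `λ(h) ≤ -3/2`, i.e. if and only if `m ≤ -2`. -/
theorem verma_simple_iff_of_half_integral (zz : ℂ) (hzz : zz ≠ 0) (m : ℤ) :
    IsSimpleModule U (Verma ((m : ℂ) + 1 / 2) zz) ↔ m ≤ -2 := by
  have : NeZero zz := ⟨hzz⟩
  rw [(vermaEquivModel _ zz).isSimpleModule_iff, Model.isSimpleModule_iff_forall_ne]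
  have key (n : ℕ) : (m : ℂ) + 1 / 2 + 1 / 2 = n ↔ m + 1 = n := by
    rw [add_assoc, add_halves]
    exact_mod_cast Iff.rfl
  simp only [ne_eq, key]
  constructor
  · intro h
    have := h (m + 1).toNat
    lia
  · intro h n
    lia

end Schrodinger
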